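/- arXiv:2605.09126 — 2 statements merged into one kernel-verified Lean document; each statement's English description precedes it below -/
import Mathlib

section
/- Let F : ℝ^d → ℝ be L-smooth and bounded below by F*, let α > 0 and τ_cut ≥ 1/α, and let (τ_t)_{t<T} be delays with 0 ≤ τ_t ≤ min(t, τ_cut). Set σ_t = γ(τ_t)·e^{−ατ_t}. Suppose the iterates satisfy θ_{t+1} = θ_t + η·σ_t·Δ_t, where Δ_t is a random vector that is conditionally unbiased for the stale negative gradient, E[Δ_t | 𝓕_t] = −∇F(θ_{t−τ_t}), satisfies E‖Δ_t‖² ≤ σ_g², and has sup-norm at most 1 almost surely (so each step satisfies ‖θ_{t+1} − θ_t‖ ≤ η·σ_t). Let G = sup_t E‖∇F(θ_t)‖ and choose η = c/√T for some c > 0. Then (1/T)·Σ_{t=0}^{T−1} σ_t·E‖∇F(θ_t)‖² ≤ (F(θ_0) − F*)/(c√T) + L·c·σ_g²/(2√T) + L·c·G/(e·α·√T). In particular the staleness-bias term L·c·G/(e·α·√T) depends only on α and not on the realized maximum delay. -/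
open MeasureTheory

/-- The cosine gate: `γ(τ) = (1 + cos (π τ / τ_cut)) / 2` for `τ ≤ τ_cut`, and `0` past
the cutoff. -/
noncomputable def cosineGate (τcut τ : ℝ) : ℝ :=
  if τ ≤ τcut then (1 + Real.cos (Real.pi * τ / τcut)) / 2 else 0

open scoped InnerProductSpace

theorem cosineGate_mem_Icc (τcut τ : ℝ) : cosineGate τcut τ ∈ Set.Icc (0 : ℝ) 1 := by
  unfold cosineGate
  split_ifs
  · constructor
    · linarith [Real.neg_one_le_cos (Real.pi * τ / τcut)]
    · linarith [Real.cos_le_one (Real.pi * τ / τcut)]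
  · simp

theorem mul_exp_neg_mul_le {α : ℝ} (hα : 0 < α) (x : ℝ) :
    Real.exp (-α * x) * x ≤ 1 / (Real.exp 1 * α) := by
  have h : α * x ≤ Real.exp (α * x - 1) := by linarith [Real.add_one_le_exp (α * x - 1)]
  rw [le_div_iff₀ (by positivity)]
  calc Real.exp (-α * x) * x * (Real.exp 1 * α)
      = Real.exp (-α * x) * Real.exp 1 * (α * x) := by ring
    _ ≤ Real.exp (-α * x) * Real.exp 1 * Real.exp (α * x - 1) := by gcongr
    _ = 1 := by
      rw [← Real.exp_add, ← Real.exp_add]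
      ring_nf
      exact Real.exp_zero

section Smooth

variable {E : Type*} [NormedAddCommGroup E] [InnerProductSpace ℝ E] [CompleteSpace E]
  {F : E → ℝ} {L : ℝ}

theorem continuous_gradient_of_lipschitz
    (hL : ∀ x y, ‖gradient F x - gradient F y‖ ≤ L * ‖x - y‖) : Continuous (gradient F) :=
  (LipschitzWith.of_dist_le_mul (K := L.toNNReal) fun x y => by
    rw [dist_eq_norm, dist_eq_norm]
    exact (hL x y).trans (by gcongr; exact Real.le_coe_toNNReal L)).continuous

/-- The quadratic upper bound for a function with Lipschitz gradient. -/
theorem le_add_inner_gradient_add_sq (hF : Differentiable ℝ F)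
    (hL : ∀ x y, ‖gradient F x - gradient F y‖ ≤ L * ‖x - y‖) (x v : E) :
    F (x + v) ≤ F x + ⟪gradient F x, v⟫_ℝ + L / 2 * ‖v‖ ^ 2 := by
  have hderiv (s : ℝ) : HasDerivAt
      (fun s : ℝ => F (x + s • v) - s * ⟪gradient F x, v⟫_ℝ - L / 2 * ‖v‖ ^ 2 * s ^ 2)
      (⟪gradient F (x + s • v), v⟫_ℝ - ⟪gradient F x, v⟫_ℝ - L * ‖v‖ ^ 2 * s) s := by
    have hline : HasDerivAt (fun s : ℝ => x + s • v) v s := by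
      simpa using ((hasDerivAt_id s).smul_const v).const_add x
    have hcomp : HasDerivAt (fun s : ℝ => F (x + s • v)) ⟪gradient F (x + s • v), v⟫_ℝ s := by
      simpa [Function.comp_def] using
        (hF (x + s • v)).hasGradientAt.hasFDerivAt.comp_hasDerivAt s hline
    refine ((hcomp.sub ((hasDerivAt_id s).mul_const ⟪gradient F x, v⟫_ℝ)).sub
      ((hasDerivAt_pow 2 s).const_mul (L / 2 * ‖v‖ ^ 2))).congr_deriv ?_
    push_cast
    ring
  have hanti := antitoneOn_of_hasDerivWithinAt_nonpos (convex_Icc (0 : ℝ) 1)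
    (fun s _ => (hderiv s).continuousAt.continuousWithinAt)
    (fun s _ => (hderiv s).hasDerivWithinAt) (fun s hs => by
      rw [interior_Icc] at hs
      have h1 := real_inner_le_norm (gradient F (x + s • v) - gradient F x) v
      have h2 := hL (x + s • v) x
      rw [add_sub_cancel_left, norm_smul, Real.norm_of_nonneg hs.1.le] at h2
      rw [inner_sub_left] at h1
      nlinarith [mul_le_mul_of_nonneg_right h2 (norm_nonneg v)])
  have := hanti (Set.left_mem_Icc.2 zero_le_one) (Set.right_mem_Icc.2 zero_le_one) zero_le_one
  simp only [one_smul, zero_smul, add_zero] at this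
  linarith

end Smooth

section Probability

variable {Ω : Type*} {m' m : MeasurableSpace Ω} {μ : Measure Ω}

theorem MeasureTheory.integral_inner_condExp_of_bound [IsFiniteMeasure μ] {E : Type*}
    [NormedAddCommGroup E] [InnerProductSpace ℝ E] [CompleteSpace E] (hm : m' ≤ m)
    {f g : Ω → E} (hf : AEStronglyMeasurable[m'] f μ) (hg : Integrable g μ) (C : ℝ)
    (hC : ∀ᵐ ω ∂μ, ‖f ω‖ ≤ C) :
    ∫ ω, ⟪f ω, (μ[g | m']) ω⟫_ℝ ∂μ = ∫ ω, ⟪f ω, g ω⟫_ℝ ∂μ := by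
  rw [← integral_condExp hm (f := fun ω => ⟪f ω, g ω⟫_ℝ)]
  exact integral_congr_ae
    (condExp_aestronglyMeasurable_bilin_of_bound (innerSL ℝ) hm hf hg C hC).symm

theorem Continuous.exists_ae_norm_comp_le {E E' : Type*} [NormedAddCommGroup E]
    [ProperSpace E] [NormedAddCommGroup E'] {h : E → E'} (hh : Continuous h) {X : Ω → E} {R : ℝ}
    (hX : ∀ᵐ ω ∂μ, ‖X ω‖ ≤ R) : ∃ C, ∀ᵐ ω ∂μ, ‖h (X ω)‖ ≤ C := by
  obtain ⟨C, hC⟩ := (isCompact_closedBall (0 : E) R).exists_bound_of_continuousOn hh.continuousOn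
  exact ⟨C, hX.mono fun ω hω => hC _ (by simpa using hω)⟩

theorem Continuous.integrable_comp_of_ae_norm_le [IsFiniteMeasure μ] {E E' : Type*}
    [NormedAddCommGroup E] [ProperSpace E] [NormedAddCommGroup E'] {h : E → E'}
    (hh : Continuous h) {X : Ω → E} (hXm : AEStronglyMeasurable X μ) {R : ℝ}
    (hX : ∀ᵐ ω ∂μ, ‖X ω‖ ≤ R) : Integrable (fun ω => h (X ω)) μ := by
  obtain ⟨C, hC⟩ := hh.exists_ae_norm_comp_le hX
  exact Integrable.of_bound (hh.comp_aestronglyMeasurable hXm) C hC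

/-- Expected decrease of a function with Lipschitz gradient along one stochastic step whose
direction is conditionally unbiased for the negative gradient at a nearby stale point. -/
theorem mul_integral_norm_gradient_sq_le [IsProbabilityMeasure μ] {E : Type*}
    [NormedAddCommGroup E] [InnerProductSpace ℝ E] [FiniteDimensional ℝ E]
    {F : E → ℝ} {L : ℝ} (hF : Differentiable ℝ F)
    (hL : ∀ x y, ‖gradient F x - gradient F y‖ ≤ L * ‖x - y‖) (hL0 : 0 ≤ L) (hm : m' ≤ m)
    {X Y D : Ω → E} {R B δ s : ℝ} (hs : 0 ≤ s)
    (hXm : StronglyMeasurable[m'] X) (hX : ∀ᵐ ω ∂μ, ‖X ω‖ ≤ R)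
    (hDm : AEStronglyMeasurable D μ) (hD : ∀ᵐ ω ∂μ, ‖D ω‖ ≤ B)
    (hunb : μ[D | m'] =ᵐ[μ] fun ω => -gradient F (Y ω))
    (hXY : ∀ᵐ ω ∂μ, ‖X ω - Y ω‖ ≤ δ) :
    s * ∫ ω, ‖gradient F (X ω)‖ ^ 2 ∂μ ≤
      ∫ ω, F (X ω) ∂μ - ∫ ω, F (X ω + s • D ω) ∂μ
        + L * (s * δ) * ∫ ω, ‖gradient F (X ω)‖ ∂μ
        + L / 2 * s ^ 2 * ∫ ω, ‖D ω‖ ^ 2 ∂μ := by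
  have hgc : Continuous (gradient F) := continuous_gradient_of_lipschitz hL
  have hXm' : AEStronglyMeasurable X μ := (hXm.mono hm).aestronglyMeasurable
  obtain ⟨C, hC⟩ := hgc.exists_ae_norm_comp_le hX
  have hDi : Integrable D μ := Integrable.of_bound hDm B hD
  have hD2i : Integrable (fun ω => ‖D ω‖ ^ 2) μ :=
    Continuous.integrable_comp_of_ae_norm_le (h := fun x : E => ‖x‖ ^ 2) (by fun_prop) hDm hD
  have hFi : Integrable (fun ω => F (X ω)) μ :=
    hF.continuous.integrable_comp_of_ae_norm_le hXm' hX
  have hFi' : Integrable (fun ω => F (X ω + s • D ω)) μ := by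
    refine hF.continuous.integrable_comp_of_ae_norm_le (hXm'.add (hDm.const_smul s))
      (R := R + s * B) ?_
    filter_upwards [hX, hD] with ω h1 h2
    refine (norm_add_le _ _).trans (add_le_add h1 ?_)
    rw [norm_smul, Real.norm_of_nonneg hs]
    gcongr
  have hgi : Integrable (fun ω => ‖gradient F (X ω)‖) μ :=
    hgc.norm.integrable_comp_of_ae_norm_le hXm' hX
  have hg2i : Integrable (fun ω => ‖gradient F (X ω)‖ ^ 2) μ :=
    (hgc.norm.pow 2).integrable_comp_of_ae_norm_le hXm' hX
  have hgm : StronglyMeasurable[m'] (fun ω => gradient F (X ω)) := hgc.comp_stronglyMeasurable hXm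
  have hgm' : AEStronglyMeasurable (fun ω => gradient F (X ω)) μ :=
    (hgm.mono hm).aestronglyMeasurable
  have hinner {g : Ω → E} (hg : Integrable g μ) :
      Integrable (fun ω => ⟪gradient F (X ω), g ω⟫_ℝ) μ :=
    (innerSL ℝ).integrable_of_bilin_of_bdd_left C hgm' hC hg
  have hlin : Integrable (fun ω => F (X ω) + s * ⟪gradient F (X ω), D ω⟫_ℝ) μ :=
    hFi.add ((hinner hDi).const_mul s)
  have hdescent : ∫ ω, F (X ω + s • D ω) ∂μ ≤
      ∫ ω, F (X ω) ∂μ + s * ∫ ω, ⟪gradient F (X ω), D ω⟫_ℝ ∂μ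
        + L / 2 * s ^ 2 * ∫ ω, ‖D ω‖ ^ 2 ∂μ := by
    rw [← integral_const_mul, ← integral_const_mul,
      ← integral_add hFi ((hinner hDi).const_mul s),
      ← integral_add hlin (hD2i.const_mul _)]
    refine integral_mono hFi' (hlin.add (hD2i.const_mul _)) fun ω => ?_
    have := le_add_inner_gradient_add_sq hF hL (X ω) (s • D ω)
    rw [inner_smul_right, norm_smul, mul_pow, Real.norm_eq_abs, sq_abs, ← mul_assoc] at this
    exact this
  have hbias : ∫ ω, ⟪gradient F (X ω), D ω⟫_ℝ ∂μ ≤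
      L * δ * ∫ ω, ‖gradient F (X ω)‖ ∂μ - ∫ ω, ‖gradient F (X ω)‖ ^ 2 ∂μ := by
    rw [← integral_inner_condExp_of_bound hm hgm.aestronglyMeasurable hDi C hC,
      ← integral_const_mul, ← integral_sub (hgi.const_mul _) hg2i]
    refine integral_mono_ae (hinner integrable_condExp) ((hgi.const_mul _).sub hg2i) ?_
    filter_upwards [hunb, hXY] with ω h1 h2
    have h3 := real_inner_le_norm (gradient F (X ω)) (gradient F (X ω) - gradient F (Y ω))
    have h4 : ‖gradient F (X ω) - gradient F (Y ω)‖ ≤ L * δ :=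
      (hL _ _).trans (by gcongr)
    rw [inner_sub_right, real_inner_self_eq_norm_sq] at h3
    simp only [h1, inner_neg_right]
    nlinarith [mul_le_mul_of_nonneg_left h4 (norm_nonneg (gradient F (X ω)))]
  nlinarith [mul_le_mul_of_nonneg_left hbias hs]

end Probability

theorem norm_sub_le_mul_of_norm_succ_sub_le {E : Type*} [SeminormedAddCommGroup E] {u : ℕ → E}
    {T : ℕ} {η : ℝ} (h : ∀ t < T, ‖u (t + 1) - u t‖ ≤ η) (s k : ℕ) (hk : s + k ≤ T) :
    ‖u (s + k) - u s‖ ≤ k * η := by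
  induction k with
  | zero => simp
  | succ k ih =>
    have h1 := ih (by omega)
    have h2 := h (s + k) (by omega)
    have h3 := norm_sub_le_norm_sub_add_norm_sub (u (s + k + 1)) (u (s + k)) (u s)
    push_cast
    rw [← add_assoc]
    linarith

/-- **Convergence rate of the idealized gated-adaptive update.**
`F : ℝ^d → ℝ` is `L`-smooth (differentiable with `L`-Lipschitz gradient, Euclidean norm)
and bounded below by `F*`; `α > 0`, `τ_cut ≥ 1/α`; delays satisfy `τ t ≤ min (t, τ_cut)`.
With `σ t = γ (τ t) e^{-α τ t}`, the iterates satisfy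
`θ (t+1) = θ t + (η * σ t) • Δ t`, where `Δ t` is conditionally unbiased for the stale
negative gradient `E[Δ t | 𝓕 t] = -∇F (θ (t - τ t))`, has second moment
`E ‖Δ t‖² ≤ σ_g²`, sup-norm at most `1` a.s. (so each step has norm at most `η σ t`).
With `G ≥ sup_t E ‖∇F (θ t)‖` and `η = c / √T`:
`(1/T) ∑_{t<T} σ t · E ‖∇F (θ t)‖² ≤ (F θ₀ - F*)/(c √T) + L c σ_g²/(2 √T) + L c G/(e α √T)`,
the staleness-bias term depending only on `α`, not on the realized maximum delay. -/
theorem stmt_1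
    (d : ℕ) (hd : 0 < d)
    (F : EuclideanSpace ℝ (Fin d) → ℝ) (L Fstar : ℝ)
    (hF : Differentiable ℝ F)
    (hL : ∀ x y, ‖gradient F x - gradient F y‖ ≤ L * ‖x - y‖)
    (hFstar : ∀ x, Fstar ≤ F x)
    (α τcut : ℝ) (hα : 0 < α) (hτcut : 1 / α ≤ τcut)
    (T : ℕ) (hT : 1 ≤ T)
    (τ : ℕ → ℕ) (hτ : ∀ t < T, τ t ≤ t ∧ (τ t : ℝ) ≤ τcut)
    (c σg G : ℝ) (hc : 0 < c)
    (Ω : Type*) [m : MeasurableSpace Ω] (μ : Measure Ω) [IsProbabilityMeasure μ]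
    (𝓕 : Filtration ℕ m)
    (θ Δ : ℕ → Ω → EuclideanSpace ℝ (Fin d))
    (hadapt : Adapted 𝓕 θ)
    (θ0 : EuclideanSpace ℝ (Fin d)) (hθ0 : ∀ ω, θ 0 ω = θ0)
    (σt : ℕ → ℝ)
    (hσ : ∀ t, σt t = cosineGate τcut (τ t : ℝ) * Real.exp (-α * (τ t : ℝ)))
    (η : ℝ) (hη : η = c / Real.sqrt T)
    (hupd : ∀ t, ∀ ω, θ (t + 1) ω = θ t ω + (η * σt t) • Δ t ω)
    (hunbiased : ∀ t < T,
      μ[Δ t | 𝓕 t] =ᵐ[μ] fun ω => -gradient F (θ (t - τ t) ω))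
    (hvar : ∀ t < T, ∫ ω, ‖Δ t ω‖ ^ 2 ∂μ ≤ σg ^ 2)
    (hsup : ∀ t < T, ∀ᵐ ω ∂μ, ∀ i : Fin d, |Δ t ω i| ≤ 1)
    (hstep : ∀ t < T, ∀ᵐ ω ∂μ, ‖θ (t + 1) ω - θ t ω‖ ≤ η * σt t)
    (hG : ∀ t, ∫ ω, ‖gradient F (θ t ω)‖ ∂μ ≤ G) :
    (1 / (T : ℝ)) * ∑ t ∈ Finset.range T, σt t * ∫ ω, ‖gradient F (θ t ω)‖ ^ 2 ∂μ ≤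
      (F θ0 - Fstar) / (c * Real.sqrt T)
      + L * c * σg ^ 2 / (2 * Real.sqrt T)
      + L * c * G / (Real.exp 1 * α * Real.sqrt T) := by
  have hT0 : (0 : ℝ) < T := by exact_mod_cast hT
  have hη0 : 0 < η := by rw [hη]; positivity
  have hL0 : 0 ≤ L := by
    let e : EuclideanSpace ℝ (Fin d) := EuclideanSpace.single ⟨0, hd⟩ 1
    have h := (norm_nonneg _).trans (hL e 0)
    simpa [e] using h
  have hG0 : 0 ≤ G := (integral_nonneg fun _ => norm_nonneg _).trans (hG 0)
  have hσ0 (t : ℕ) : 0 ≤ σt t := by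
    rw [hσ]
    exact mul_nonneg (cosineGate_mem_Icc _ _).1 (Real.exp_pos _).le
  have hσexp (t : ℕ) : σt t ≤ Real.exp (-α * τ t) := by
    rw [hσ]
    exact mul_le_of_le_one_left (Real.exp_pos _).le (cosineGate_mem_Icc _ _).2
  have hσ1 (t : ℕ) : σt t ≤ 1 := (hσexp t).trans <| Real.exp_le_one_iff.2 <| by
    rw [neg_mul, neg_nonpos]
    positivity
  have hστ (t : ℕ) : σt t * τ t ≤ 1 / (Real.exp 1 * α) :=
    (mul_le_mul_of_nonneg_right (hσexp t) (Nat.cast_nonneg _)).trans (mul_exp_neg_mul_le hα _)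
  have hsteps : ∀ᵐ ω ∂μ, ∀ t < T, ‖θ (t + 1) ω - θ t ω‖ ≤ η := by
    rw [ae_all_iff]
    intro t
    by_cases ht : t < T
    · filter_upwards [hstep t ht] with ω hω _
      exact hω.trans (mul_le_of_le_one_right hη0.le (hσ1 t))
    · simp [ht]
  have hbound (t : ℕ) (ht : t ≤ T) : ∀ᵐ ω ∂μ, ‖θ t ω‖ ≤ ‖θ0‖ + t * η := by
    filter_upwards [hsteps] with ω hω
    have h := norm_sub_le_mul_of_norm_succ_sub_le (u := fun t => θ t ω) hω 0 t (by omega)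
    simp only [zero_add, hθ0] at h
    linarith [norm_le_norm_add_norm_sub' (θ t ω) θ0]
  have hmeas (t : ℕ) : StronglyMeasurable[𝓕 t] (θ t) :=
    (hadapt t).stronglyMeasurable
  have hmeas' (t : ℕ) : AEStronglyMeasurable (θ t) μ :=
    ((hmeas t).mono (𝓕.le t)).aestronglyMeasurable
  have hone (t : ℕ) (ht : t < T) :
      η * (σt t * ∫ ω, ‖gradient F (θ t ω)‖ ^ 2 ∂μ) ≤
        (∫ ω, F (θ t ω) ∂μ - ∫ ω, F (θ (t + 1) ω) ∂μ)
          + η * (L * η * σg ^ 2 / 2 + L * η * G / (Real.exp 1 * α)) := by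
    rcases (hσ0 t).eq_or_lt with h0 | hpos
    · have : ∀ ω, θ (t + 1) ω = θ t ω := fun ω => by simp [hupd, ← h0]
      simp only [this, ← h0, zero_mul, mul_zero, sub_self, zero_add]
      positivity
    have hs : 0 < η * σt t := mul_pos hη0 hpos
    have hDeq : Δ t = fun ω => (η * σt t)⁻¹ • (θ (t + 1) ω - θ t ω) := by
      funext ω
      rw [hupd, add_sub_cancel_left, inv_smul_smul₀ hs.ne']
    have hDm : AEStronglyMeasurable (Δ t) μ := by
      rw [hDeq]
      exact ((hmeas' (t + 1)).sub (hmeas' t)).const_smul (η * σt t)⁻¹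
    have hD : ∀ᵐ ω ∂μ, ‖Δ t ω‖ ≤ 1 := by
      filter_upwards [hstep t ht] with ω hω
      rw [hupd, add_sub_cancel_left, norm_smul, Real.norm_of_nonneg hs.le] at hω
      exact le_of_mul_le_mul_left (by simpa using hω) hs
    have hstale : ∀ᵐ ω ∂μ, ‖θ t ω - θ (t - τ t) ω‖ ≤ τ t * η := by
      filter_upwards [hsteps] with ω hω
      have hle := (hτ t ht).1
      simpa [Nat.sub_add_cancel hle] using norm_sub_le_mul_of_norm_succ_sub_le
        (u := fun t => θ t ω) hω (t - τ t) (τ t) (by omega)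
    have h := mul_integral_norm_gradient_sq_le hF hL hL0 (𝓕.le t) hs.le (hmeas t)
      (hbound t ht.le) hDm hD (hunbiased t ht) hstale
    simp only [← hupd] at h
    have hbias : L * (η * σt t * (τ t * η)) * ∫ ω, ‖gradient F (θ t ω)‖ ∂μ ≤
        η * (L * η * G / (Real.exp 1 * α)) := by
      calc L * (η * σt t * (τ t * η)) * ∫ ω, ‖gradient F (θ t ω)‖ ∂μ
          ≤ L * (η * σt t * (τ t * η)) * G := by
            gcongr
            exact hG t
        _ = L * η ^ 2 * G * (σt t * τ t) := by ring
        _ ≤ L * η ^ 2 * G * (1 / (Real.exp 1 * α)) := by gcongr; exact hστ t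
        _ = η * (L * η * G / (Real.exp 1 * α)) := by ring
    have hnoise : L / 2 * (η * σt t) ^ 2 * ∫ ω, ‖Δ t ω‖ ^ 2 ∂μ ≤
        η * (L * η * σg ^ 2 / 2) := by
      calc L / 2 * (η * σt t) ^ 2 * ∫ ω, ‖Δ t ω‖ ^ 2 ∂μ
          ≤ L / 2 * (η * 1) ^ 2 * σg ^ 2 := by
            gcongr
            · exact hσ1 t
            · exact hvar t ht
        _ = η * (L * η * σg ^ 2 / 2) := by ring
    linarith
  have hsum := Finset.sum_le_sum fun t ht => hone t (Finset.mem_range.1 ht)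
  rw [← Finset.mul_sum, Finset.sum_add_distrib, Finset.sum_range_sub', Finset.sum_const,
    Finset.card_range, nsmul_eq_mul] at hsum
  have hinit : ∫ ω, F (θ 0 ω) ∂μ = F θ0 := by simp [hθ0]
  have hfinal : Fstar ≤ ∫ ω, F (θ T ω) ∂μ := by
    have h := integral_mono (integrable_const Fstar)
      (hF.continuous.integrable_comp_of_ae_norm_le (hmeas' T) (hbound T le_rfl))
      (fun ω => hFstar (θ T ω))
    simpa using h
  have hsq : Real.sqrt T ≠ 0 := by positivity
  have hηT : η * T = c * Real.sqrt T := by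
    rw [hη, div_mul_eq_mul_div, div_eq_iff hsq, mul_assoc, Real.mul_self_sqrt hT0.le]
  calc (1 / (T : ℝ)) * ∑ t ∈ Finset.range T, σt t * ∫ ω, ‖gradient F (θ t ω)‖ ^ 2 ∂μ
      = (η * ∑ t ∈ Finset.range T, σt t * ∫ ω, ‖gradient F (θ t ω)‖ ^ 2 ∂μ) / (η * T) := by
        field_simp
    _ ≤ ((F θ0 - Fstar)
          + T * (η * (L * η * σg ^ 2 / 2 + L * η * G / (Real.exp 1 * α)))) / (η * T) := by
        gcongr
        linarith
    _ = (F θ0 - Fstar) / (η * T) + L * η * σg ^ 2 / 2 + L * η * G / (Real.exp 1 * α) := by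
        field_simp
        ring
    _ = _ := by
        rw [hηT, hη]
        field_simp
end

section
/- Let F : ℝ^d → ℝ be L-smooth with ‖∇F(x)‖ ≤ G for all x, let η > 0, let t be a step, let τ_t be a natural number with τ_t ≤ t, and let σ_t ∈ [0,1]. Suppose the iterates satisfy θ_{s+1} = θ_s − η·σ_s·∇F(θ_{s−τ_s}) for all s ≤ t, with every scalar σ_s ∈ [0,1] and every delay τ_s ≤ s. Then the single-step descent inequality holds: F(θ_{t+1}) ≤ F(θ_t) − η·σ_t·‖∇F(θ_t)‖² + L·G·η²·σ_t·τ_t·‖∇F(θ_t)‖ + (L/2)·η²·σ_t²·G². -/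
open scoped RealInnerProductSpace in
/-- Descent lemma: a function with `L`-Lipschitz gradient lies below its quadratic model. -/
theorem le_add_inner_add_of_gradient_lipschitz {E : Type*} [NormedAddCommGroup E]
    [InnerProductSpace ℝ E] [CompleteSpace E] {F : E → ℝ} {L : ℝ} (hF : Differentiable ℝ F)
    (hL : ∀ x y, ‖gradient F x - gradient F y‖ ≤ L * ‖x - y‖) (x v : E) :
    F (x + v) ≤ F x + ⟪gradient F x, v⟫ + L / 2 * ‖v‖ ^ 2 := by
  let g : ℝ → ℝ := fun s => F (x + s • v) - s * ⟪gradient F x, v⟫ - s ^ 2 * (L / 2 * ‖v‖ ^ 2)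
  have hg (s : ℝ) : HasDerivAt g
      (⟪gradient F (x + s • v) - gradient F x, v⟫ - s * (L * ‖v‖ ^ 2)) s := by
    have hline : HasDerivAt (fun s : ℝ => x + s • v) v s := by
      simpa using ((hasDerivAt_id s).smul_const v).const_add x
    have hcomp : HasDerivAt (fun s : ℝ => F (x + s • v)) ⟪gradient F (x + s • v), v⟫ s := by
      simpa [Function.comp_def] using
        (hF (x + s • v)).hasGradientAt.hasFDerivAt.comp_hasDerivAt s hline
    have h := (hcomp.sub ((hasDerivAt_id s).mul_const ⟪gradient F x, v⟫)).sub
      ((hasDerivAt_pow 2 s).mul_const (L / 2 * ‖v‖ ^ 2))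
    refine h.congr_deriv ?_
    rw [inner_sub_left]
    push_cast
    ring
  have hanti : AntitoneOn g (Set.Icc 0 1) := by
    refine antitoneOn_of_deriv_nonpos (convex_Icc 0 1)
      (fun s _ => (hg s).continuousAt.continuousWithinAt)
      (fun s _ => (hg s).differentiableAt.differentiableWithinAt) fun s hs => ?_
    rw [interior_Icc] at hs
    rw [(hg s).deriv, sub_nonpos]
    calc ⟪gradient F (x + s • v) - gradient F x, v⟫
        ≤ ‖gradient F (x + s • v) - gradient F x‖ * ‖v‖ := real_inner_le_norm _ _
      _ ≤ L * ‖x + s • v - x‖ * ‖v‖ := by gcongr; exact hL _ _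
      _ = s * (L * ‖v‖ ^ 2) := by
        rw [add_sub_cancel_left, norm_smul, Real.norm_of_nonneg hs.1.le]
        ring
  have h := hanti (Set.left_mem_Icc.2 zero_le_one) (Set.right_mem_Icc.2 zero_le_one) zero_le_one
  simp only [g, one_smul, zero_smul, add_zero] at h
  linarith

/-- A sequence whose first `t` steps have length at most `C` drifts by at most `C * k` over the
last `k` of them. -/
theorem norm_sub_le_mul_of_norm_step_le {E : Type*} [SeminormedAddCommGroup E] {u : ℕ → E}
    {C : ℝ} {k t : ℕ} (hk : k ≤ t) (hu : ∀ s < t, ‖u (s + 1) - u s‖ ≤ C) :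
    ‖u t - u (t - k)‖ ≤ C * k := by
  have h := dist_le_Ico_sum_of_dist_le (f := u) (d := fun _ => C) (Nat.sub_le t k)
    fun {s} _ hs => by rw [dist_comm, dist_eq_norm]; exact hu s hs
  rw [dist_comm, dist_eq_norm] at h
  simpa [Nat.sub_sub_self hk, mul_comm] using h


/-- **single-step descent inequality.** Let `F : ℝ^d → ℝ` be `L`-smooth
(differentiable with `L`-Lipschitz gradient) with `‖∇F x‖ ≤ G` everywhere, let `η > 0`,
and suppose the iterates follow the gated delayed-gradient update
`θ (s+1) = θ s - (η * σ s) • ∇F (θ (s - τ s))` for all `s ≤ t`, with every scalar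
`σ s ∈ [0,1]` and every delay `τ s ≤ s`. Then
`F (θ (t+1)) ≤ F (θ t) - η σ_t ‖∇F (θ t)‖² + L G η² σ_t τ_t ‖∇F (θ t)‖ + (L/2) η² σ_t² G²`. -/
theorem stmt_11 (d : ℕ) (hd : 0 < d) (L G η : ℝ) (hη : 0 < η)
    (F : EuclideanSpace ℝ (Fin d) → ℝ)
    (hF : Differentiable ℝ F)
    (hL : ∀ x y, ‖gradient F x - gradient F y‖ ≤ L * ‖x - y‖)
    (hG : ∀ x, ‖gradient F x‖ ≤ G)
    (θ : ℕ → EuclideanSpace ℝ (Fin d))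
    (σ : ℕ → ℝ) (hσ : ∀ s, σ s ∈ Set.Icc (0 : ℝ) 1)
    (τ : ℕ → ℕ) (hτ : ∀ s, τ s ≤ s)
    (t : ℕ)
    (hupd : ∀ s ≤ t, θ (s + 1) = θ s - (η * σ s) • gradient F (θ (s - τ s))) :
    F (θ (t + 1)) ≤ F (θ t) - η * σ t * ‖gradient F (θ t)‖ ^ 2
      + L * G * η ^ 2 * σ t * (τ t : ℝ) * ‖gradient F (θ t)‖
      + (L / 2) * η ^ 2 * (σ t) ^ 2 * G ^ 2 := by
  have hL0 : 0 ≤ L := by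
    have h := (norm_nonneg _).trans (hL (EuclideanSpace.single ⟨0, hd⟩ 1) 0)
    simpa using h
  have hησ (s : ℕ) : 0 ≤ η * σ s := mul_nonneg hη.le (hσ s).1
  have hdrift : ‖θ t - θ (t - τ t)‖ ≤ η * G * τ t := by
    refine norm_sub_le_mul_of_norm_step_le (hτ t) fun s hs => ?_
    rw [hupd s hs.le, sub_sub_cancel_left, norm_neg, norm_smul, Real.norm_of_nonneg (hησ s)]
    exact mul_le_mul (mul_le_of_le_one_right hη.le (hσ s).2) (hG _) (norm_nonneg _) hη.le
  have hdesc := le_add_inner_add_of_gradient_lipschitz hF hL (θ t)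
    (-((η * σ t) • gradient F (θ (t - τ t))))
  rw [← sub_eq_add_neg, ← hupd t le_rfl, inner_neg_right, real_inner_smul_right, norm_neg,
    norm_smul, Real.norm_of_nonneg (hησ t)] at hdesc
  have hbias : ‖gradient F (θ t)‖ ^ 2 - inner ℝ (gradient F (θ t)) (gradient F (θ (t - τ t)))
      ≤ ‖gradient F (θ t)‖ * (L * (η * G * τ t)) := by
    rw [← real_inner_self_eq_norm_sq, ← inner_sub_right]
    refine (real_inner_le_norm _ _).trans ?_
    gcongr
    exact (hL _ _).trans (by gcongr)
  have hquad : L / 2 * (η * σ t * ‖gradient F (θ (t - τ t))‖) ^ 2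
      ≤ L / 2 * (η * σ t * G) ^ 2 := by
    have := hησ t
    gcongr
    exact hG _
  linarith [mul_le_mul_of_nonneg_left hbias (hησ t)]
end
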